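/- arXiv:2310.04969 — 2 statements merged into one kernel-verified Lean document; each statement's English description precedes it below -/
import Mathlib

section
/- For every n ≥ 1, the binomial-Eulerian polynomial satisfies Ã_n(x) = ∑_{k=0}^{⌊n/2⌋} γ̃_{n,k} x^k (1+x)^{n−2k} as an identity of polynomials in ℤ[x], where γ̃_{n,k} is the number of permutations σ ∈ PRW_{n+1} with asc(σ) = k and da(σ) = 0 (no double ascents). -/
/-- The letter at (1-based) position `i` of the word `w`, with the boundary
convention that positions `0` and `> w.length` carry the value `w.length + 1`
(playing the role of `+∞` for a permutation word of `{1,…,n}`). -/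
def wB (w : List ℕ) (i : ℕ) : ℕ :=
  if 1 ≤ i ∧ i ≤ w.length then w.getD (i - 1) 0 else w.length + 1

/-- The one-line word `σ_1 ⋯ σ_n` (with letters in `{1,…,n}`) of a permutation of `Fin n`. -/
def word {n : ℕ} (σ : Equiv.Perm (Fin n)) : List ℕ := List.ofFn (fun i => (σ i : ℕ) + 1)

/-- Number of descents: indices `i ∈ {1,…,n-1}` with `σ_i > σ_{i+1}`. -/
def desW (w : List ℕ) : ℕ :=
  ((Finset.Icc 1 (w.length - 1)).filter (fun i => wB w (i + 1) < wB w i)).card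

/-- Number of ascents: indices `i ∈ {1,…,n-1}` with `σ_i < σ_{i+1}`. -/
def ascW (w : List ℕ) : ℕ :=
  ((Finset.Icc 1 (w.length - 1)).filter (fun i => wB w i < wB w (i + 1))).card

/-- Position `i` is a double ascent: `σ_{i-1} < σ_i < σ_{i+1}` (boundary `σ_0 = σ_{n+1} = +∞`). -/
abbrev isDAat (w : List ℕ) (i : ℕ) : Prop := wB w (i - 1) < wB w i ∧ wB w i < wB w (i + 1)

/-- Position `i` is a double descent: `σ_{i-1} > σ_i > σ_{i+1}`. -/
abbrev isDDat (w : List ℕ) (i : ℕ) : Prop := wB w i < wB w (i - 1) ∧ wB w (i + 1) < wB w i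

/-- Position `i` is a peak: `σ_{i-1} < σ_i > σ_{i+1}`. -/
abbrev isPkat (w : List ℕ) (i : ℕ) : Prop := wB w (i - 1) < wB w i ∧ wB w (i + 1) < wB w i

/-- Position `i` is a valley: `σ_{i-1} > σ_i < σ_{i+1}`. -/
abbrev isVlat (w : List ℕ) (i : ℕ) : Prop := wB w i < wB w (i - 1) ∧ wB w i < wB w (i + 1)

/-- Position `i` holds a left-to-right minimum: `σ_j > σ_i` for all `j < i`. -/
abbrev isLRat (w : List ℕ) (i : ℕ) : Prop := ∀ j ∈ Finset.Icc 1 (i - 1), wB w i < wB w j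

/-- Position `i` holds a right-to-left minimum: `σ_j > σ_i` for all `j > i`. -/
abbrev isRLat (w : List ℕ) (i : ℕ) : Prop := ∀ j ∈ Finset.Icc (i + 1) w.length, wB w i < wB w j

/-- `da`, the number of double ascents. -/
def daW (w : List ℕ) : ℕ := ((Finset.Icc 1 w.length).filter (isDAat w)).card

/-- `dd`, the number of double descents. -/
def ddW (w : List ℕ) : ℕ := ((Finset.Icc 1 w.length).filter (isDDat w)).card

/-- `M`, the number of peaks. -/
def pkW (w : List ℕ) : ℕ := ((Finset.Icc 1 w.length).filter (isPkat w)).card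

/-- `LRmin`, the number of left-to-right minima. -/
def lrminW (w : List ℕ) : ℕ := ((Finset.Icc 1 w.length).filter (isLRat w)).card

/-- `RLmin`, the number of right-to-left minima. -/
def rlminW (w : List ℕ) : ℕ := ((Finset.Icc 1 w.length).filter (isRLat w)).card

/-- The word belongs to `PRW`: if it has an ascent, the first ascent occurs at the letter `1`. -/
abbrev isPRW (w : List ℕ) : Prop :=
  ∀ i ∈ Finset.Icc 1 (w.length - 1), wB w i < wB w (i + 1) →
    (∀ j ∈ Finset.Icc 1 (i - 1), ¬ wB w j < wB w (j + 1)) → wB w i = 1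

/-- The set `PRW_n` of permutations whose first ascent (if any) appears at the letter `1`. -/
def PRW (n : ℕ) : Finset (Equiv.Perm (Fin n)) :=
  Finset.univ.filter (fun σ => isPRW (word σ))

open Polynomial

/-- The number of adjacent pairs of letters of a word that are related by `r`. -/
def adjCount (r : ℕ → ℕ → Prop) [DecidableRel r] : List ℕ → ℕ
  | [] => 0
  | [_] => 0
  | a :: b :: l => (if r a b then 1 else 0) + adjCount r (b :: l)

/-- A word without double ascents, when a final `+∞` is appended to it. -/
def NoDoubleAscent : List ℕ → Prop
  | [] => True
  | [_] => True
  | [a, b] => b ≤ a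
  | a :: b :: c :: l => (a < b → c ≤ b) ∧ NoDoubleAscent (b :: c :: l)

/-- If the word has an ascent, then its first ascent occurs at the letter `1`. -/
def FirstAscentAtOne : List ℕ → Prop
  | [] => True
  | [_] => True
  | a :: b :: l => (a < b → a = 1) ∧ (¬ a < b → FirstAscentAtOne (b :: l))

theorem wB_add_one {w : List ℕ} {i : ℕ} (h : i < w.length) : wB w (i + 1) = w.getD i 0 := by
  simp [wB, Nat.succ_le_of_lt h]

theorem adjCount_eq_sum (r : ℕ → ℕ → Prop) [DecidableRel r] (w : List ℕ) :
    adjCount r w = ∑ i ∈ Finset.range (w.length - 1),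
      if r (w.getD i 0) (w.getD (i + 1) 0) then 1 else 0 := by
  induction w using adjCount.induct with
  | case1 => simp [adjCount]
  | case2 => simp [adjCount]
  | case3 a b l ih =>
    rw [adjCount, ih, add_comm]
    simp only [List.length_cons, Nat.add_sub_cancel]
    rw [Finset.sum_range_succ']
    simp

theorem card_filter_wB (r : ℕ → ℕ → Prop) [DecidableRel r] (w : List ℕ) :
    ((Finset.Icc 1 (w.length - 1)).filter (fun i => r (wB w i) (wB w (i + 1)))).card
      = adjCount r w := by
  rw [Finset.card_filter, adjCount_eq_sum, Finset.range_eq_Ico,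
    Finset.sum_Ico_eq_sum_range, ← Finset.Ico_add_one_right_eq_Icc, Finset.sum_Ico_eq_sum_range]
  refine Finset.sum_congr (by simp) fun i hi => ?_
  have hi' : i < w.length - 1 := by simpa using hi
  rw [add_comm 1 i, zero_add, wB_add_one (by omega), wB_add_one (by omega)]

theorem ascW_eq_adjCount (w : List ℕ) : ascW w = adjCount (· < ·) w :=
  card_filter_wB (· < ·) w

theorem desW_eq_adjCount (w : List ℕ) : desW w = adjCount (· > ·) w :=
  card_filter_wB (· > ·) w

theorem noDoubleAscent_iff_getD (w : List ℕ) :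
    NoDoubleAscent w ↔ ∀ i, i + 1 < w.length → w.getD i 0 < w.getD (i + 1) 0 →
      i + 2 < w.length ∧ w.getD (i + 2) 0 ≤ w.getD (i + 1) 0 := by
  induction w using NoDoubleAscent.induct with
  | case1 => simp [NoDoubleAscent]
  | case2 => simp [NoDoubleAscent]
  | case3 a b => simp [NoDoubleAscent]
  | case4 a b c l ih =>
    rw [NoDoubleAscent, ih]
    conv_rhs => rw [← Nat.and_forall_add_one]
    simp

theorem firstAscentAtOne_iff_getD (w : List ℕ) :
    FirstAscentAtOne w ↔ ∀ i, i + 1 < w.length → w.getD i 0 < w.getD (i + 1) 0 →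
      (∀ j < i, ¬ w.getD j 0 < w.getD (j + 1) 0) → w.getD i 0 = 1 := by
  induction w using FirstAscentAtOne.induct with
  | case1 => simp [FirstAscentAtOne]
  | case2 => simp [FirstAscentAtOne]
  | case3 a b l ih =>
    rw [FirstAscentAtOne, ih]
    conv_rhs => rw [← Nat.and_forall_add_one]
    simp only [Nat.forall_lt_succ_left]
    by_cases h : a < b <;> simp [h]

theorem daW_eq_zero_iff {w : List ℕ} (hw : ∀ a ∈ w, a ≤ w.length) :
    daW w = 0 ↔ NoDoubleAscent w := by
  have hlt : ∀ i, i < w.length → w.getD i 0 < w.length + 1 := fun i hi => by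
    rw [List.getD_eq_getElem _ _ hi]
    exact Nat.lt_succ_of_le (hw _ (List.getElem_mem hi))
  have hend : wB w (w.length + 1) = w.length + 1 := by simp [wB]
  rw [daW, Finset.card_eq_zero, Finset.filter_eq_empty_iff, noDoubleAscent_iff_getD]
  constructor
  · intro h i hi hasc
    have := @h (i + 2) (by simp; omega)
    simp only [isDAat, show i + 2 - 1 = i + 1 from rfl, not_and, not_lt] at this
    rw [wB_add_one (by omega), wB_add_one (i := i + 1) hi] at this
    rcases Nat.lt_or_ge (i + 2) w.length with h2 | h2
    · rw [wB_add_one (i := i + 2) h2] at this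
      exact ⟨h2, this hasc⟩
    · have h3 : i + 2 = w.length := by omega
      rw [h3, hend] at this
      have := this hasc
      have := hlt (i + 1) hi
      omega
  · rintro h i hi ⟨h1, h2⟩
    rw [Finset.mem_Icc] at hi
    obtain ⟨j, rfl⟩ : ∃ j, i = j + 1 := ⟨i - 1, by omega⟩
    rw [Nat.add_sub_cancel] at h1
    rw [wB_add_one (i := j) (by omega)] at h1 h2
    rcases j with _ | j
    · have := hlt 0 (by omega)
      simp only [wB] at h1
      simp at h1 this
      omega
    · rw [wB_add_one (by omega)] at h1
      obtain ⟨h3, h4⟩ := h j (by omega) h1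
      rw [wB_add_one h3] at h2
      exact absurd h2 (by simpa using h4)

theorem isPRW_iff (w : List ℕ) : isPRW w ↔ FirstAscentAtOne w := by
  rw [firstAscentAtOne_iff_getD]
  constructor
  · intro h i hi hasc hj
    have := h (i + 1) (by simp; omega)
    rw [wB_add_one (by omega), wB_add_one hi] at this
    refine this hasc fun j hj' => ?_
    rw [Finset.mem_Icc] at hj'
    obtain ⟨k, rfl⟩ : ∃ k, j = k + 1 := ⟨j - 1, by omega⟩
    rw [wB_add_one (by omega), wB_add_one (by omega)]
    exact hj k (by omega)
  · intro h i hi hasc hj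
    rw [Finset.mem_Icc] at hi
    obtain ⟨i, rfl⟩ : ∃ k, i = k + 1 := ⟨i - 1, by omega⟩
    rw [wB_add_one (by omega)] at hasc ⊢
    rw [wB_add_one (by omega)] at hasc
    refine h i (by omega) hasc fun j hj' => ?_
    have := hj (j + 1) (by simp; omega)
    rwa [wB_add_one (by omega), wB_add_one (by omega)] at this

section Append

variable {α β : List ℕ} {N : ℕ}

theorem adjCount_lt_append_cons (hα : ∀ a ∈ α, a < N) (hβ : ∀ b ∈ β, b < N) :
    adjCount (· < ·) (α ++ N :: β) = adjCount (· < ·) α + adjCount (· < ·) β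
      + if α = [] then 0 else 1 := by
  induction α using adjCount.induct with
  | case1 => cases β <;> simp_all [adjCount, not_lt_of_gt]
  | case2 a => cases β <;> simp_all [adjCount, not_lt_of_gt, add_comm]
  | case3 a b l ih =>
    have := ih fun x hx => hα x (List.mem_cons_of_mem _ hx)
    simp only [List.cons_append, adjCount] at this ⊢
    rw [this]
    simp [add_assoc]

theorem adjCount_gt_append_cons (hα : ∀ a ∈ α, a < N) (hβ : ∀ b ∈ β, b < N) :
    adjCount (· > ·) (α ++ N :: β) = adjCount (· > ·) α + adjCount (· > ·) β
      + if β = [] then 0 else 1 := by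
  induction α using adjCount.induct with
  | case1 => cases β <;> simp_all [adjCount, add_comm]
  | case2 a => cases β <;> simp_all [adjCount, add_comm, not_lt_of_gt]
  | case3 a b l ih =>
    have := ih fun x hx => hα x (List.mem_cons_of_mem _ hx)
    simp only [List.cons_append, adjCount] at this ⊢
    rw [this]
    simp [add_assoc]

theorem noDoubleAscent_append_cons (hα : ∀ a ∈ α, a < N) (hβ : ∀ b ∈ β, b < N) :
    NoDoubleAscent (α ++ N :: β) ↔
      NoDoubleAscent α ∧ NoDoubleAscent β ∧ (β = [] → α = []) := by
  have hN : NoDoubleAscent (N :: β) ↔ NoDoubleAscent β := by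
    rcases β with _ | ⟨b, _ | ⟨c, l⟩⟩
    · simp [NoDoubleAscent]
    · simp [NoDoubleAscent, le_of_lt (hβ b (by simp))]
    · have := hβ b (by simp)
      simp [NoDoubleAscent, not_lt_of_gt this]
  induction α using NoDoubleAscent.induct with
  | case1 => simp [hN, NoDoubleAscent]
  | case2 a =>
    rcases β with _ | ⟨b, l⟩
    · simp_all [NoDoubleAscent]
    · simp_all [NoDoubleAscent, le_of_lt]
  | case3 a b =>
    have := hα b (by simp)
    rcases β with _ | ⟨c, l⟩
    · simp_all [NoDoubleAscent]
    · simp_all [NoDoubleAscent, not_le_of_gt]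
      exact fun _ _ => hβ.1.le
  | case4 a b c l ih =>
    have := ih fun x hx => hα x (List.mem_cons_of_mem _ hx)
    simp only [List.cons_append, NoDoubleAscent] at this ⊢
    simp only [reduceCtorEq] at this ⊢
    tauto

theorem firstAscentAtOne_append_cons (hα : ∀ a ∈ α, 1 ≤ a ∧ a < N) (hne : α ≠ []) :
    FirstAscentAtOne (α ++ N :: β) ↔ FirstAscentAtOne α ∧ 1 ∈ α := by
  induction α using FirstAscentAtOne.induct with
  | case1 => simp at hne
  | case2 a =>
    have := hα a (by simp)
    simp [FirstAscentAtOne, this.2, eq_comm]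
  | case3 a b l ih =>
    simp only [List.cons_append, FirstAscentAtOne] at ih ⊢
    by_cases h : a < b
    · simp +contextual [h, eq_comm]
    · have := (hα b (by simp)).1
      rw [ih (fun x hx => hα x (List.mem_cons_of_mem _ hx)) (by simp)]
      simp only [h, List.mem_cons]
      grind

theorem firstAscentAtOne_cons (hβ : ∀ b ∈ β, b < N) :
    FirstAscentAtOne (N :: β) ↔ FirstAscentAtOne β := by
  rcases β with _ | ⟨b, l⟩
  · simp [FirstAscentAtOne]
  · simp [FirstAscentAtOne, not_lt_of_gt (hβ b (by simp))]

end Append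

theorem NoDoubleAscent.two_mul_adjCount_lt {w : List ℕ} (h : NoDoubleAscent w) (hw : w ≠ []) :
    2 * adjCount (· < ·) w < w.length := by
  induction w using List.twoStepInduction with
  | nil => simp at hw
  | singleton a => simp [adjCount]
  | cons_cons a b l ih1 ih2 =>
    rcases l with _ | ⟨c, l⟩
    · simp_all [NoDoubleAscent, adjCount, not_lt_of_ge]
    · obtain ⟨h1, h2⟩ := h
      have h3 := ih2 b h2 (by simp)
      have h4 : NoDoubleAscent (c :: l) := by
        rcases l with _ | ⟨d, l⟩
        · trivial
        · exact h2.2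
      have h5 := ih1 h4 (by simp)
      simp only [adjCount, List.length_cons] at *
      split_ifs at * <;> omega

/-- The words in which every letter of `A`, and no other letter, occurs exactly once. -/
def arrangements (A : Finset ℕ) : Finset (List ℕ) :=
  ⟨A.val.lists, Multiset.lists_nodup_finset A⟩

theorem mem_arrangements {A : Finset ℕ} {l : List ℕ} :
    l ∈ arrangements A ↔ l.Nodup ∧ l.toFinset = A := by
  rw [arrangements, Finset.mem_mk, Multiset.mem_lists_iff]
  constructor
  · intro h
    have hl : l.Nodup := by
      have := A.nodup
      rwa [h] at this
    refine ⟨hl, Finset.val_injective ?_⟩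
    rw [h, List.toFinset_val, hl.dedup]
    rfl
  · rintro ⟨hl, rfl⟩
    rw [List.toFinset_val, hl.dedup]
    rfl

theorem mem_of_mem_arrangements {A : Finset ℕ} {l : List ℕ} (h : l ∈ arrangements A) {a : ℕ} :
    a ∈ l ↔ a ∈ A := by
  rw [← (mem_arrangements.1 h).2, List.mem_toFinset]

theorem length_of_mem_arrangements {A : Finset ℕ} {l : List ℕ} (h : l ∈ arrangements A) :
    l.length = A.card := by
  obtain ⟨hl, rfl⟩ := mem_arrangements.1 h
  exact (List.toFinset_card_of_nodup hl).symm

theorem arrangements_empty : arrangements ∅ = {[]} := by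
  ext l
  rw [mem_arrangements, Finset.mem_singleton, List.toFinset_eq_empty_iff]
  constructor
  · exact And.right
  · rintro rfl
    simp

theorem arrangements_singleton (a : ℕ) : arrangements {a} = {[a]} := by
  ext l
  rw [arrangements, Finset.mem_mk, Multiset.mem_lists_iff, Finset.mem_singleton]
  exact eq_comm.trans Multiset.coe_eq_singleton

theorem eq_nil_iff_of_mem_arrangements {A : Finset ℕ} {l : List ℕ} (h : l ∈ arrangements A) :
    l = [] ↔ A = ∅ := by
  rw [← (mem_arrangements.1 h).2, List.toFinset_eq_empty_iff]

theorem sum_arrangements_insert {M : Type*} [AddCommMonoid M] {A : Finset ℕ} {N : ℕ} (hN : N ∉ A)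
    (F : List ℕ → M) :
    ∑ l ∈ arrangements (insert N A), F l =
      ∑ S ∈ A.powerset, ∑ α ∈ arrangements S, ∑ β ∈ arrangements (A \ S), F (α ++ N :: β) := by
  simp_rw [← Finset.sum_product']
  rw [Finset.sum_sigma']
  symm
  refine Finset.sum_bij (fun x _ => x.2.1 ++ N :: x.2.2) ?_ ?_ ?_ fun _ _ => rfl
  · rintro ⟨S, α, β⟩ hx
    simp only [Finset.mem_sigma, Finset.mem_powerset, Finset.mem_product, mem_arrangements] at hx ⊢
    obtain ⟨hS, ⟨hα, rfl⟩, hβ, hβ'⟩ := hx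
    have hmem : ∀ x, x ∈ β ↔ x ∈ A ∧ x ∉ α := fun x => by
      rw [← List.mem_toFinset, hβ', Finset.mem_sdiff, List.mem_toFinset]
    have hmem' : ∀ x ∈ α, x ∈ A := fun x hx => hS (List.mem_toFinset.2 hx)
    constructor
    · rw [List.nodup_append, List.nodup_cons]
      grind
    · ext x
      simp only [List.mem_toFinset, List.mem_append, List.mem_cons, Finset.mem_insert]
      grind
  · rintro ⟨S, α, β⟩ hx ⟨S', α', β'⟩ hx' h
    simp only [Finset.mem_sigma, Finset.mem_powerset, Finset.mem_product, mem_arrangements]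
      at hx hx' h
    obtain ⟨hS, ⟨hα, rfl⟩, hβ, hβ'⟩ := hx
    obtain ⟨hS', ⟨hα', rfl⟩, hb, hb'⟩ := hx'
    rw [List.append_cons_inj_of_notMem] at h
    · obtain ⟨rfl, -, rfl⟩ := h
      rfl
    · exact fun hN' => hN (hS (List.mem_toFinset.2 hN'))
    · intro hN'
      rw [← List.mem_toFinset, hβ', Finset.mem_sdiff] at hN'
      exact hN hN'.1
  · intro l hl
    rw [mem_arrangements] at hl
    obtain ⟨hl, hlA⟩ := hl
    obtain ⟨α, β, rfl⟩ := List.append_of_mem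
      (show N ∈ l by rw [← List.mem_toFinset, hlA]; exact Finset.mem_insert_self _ _)
    have hmem : ∀ x, x ∈ α ∨ x = N ∨ x ∈ β ↔ x = N ∨ x ∈ A := fun x => by
      simpa [or_left_comm] using congrArg (x ∈ ·) hlA
    rw [List.nodup_append, List.nodup_cons] at hl
    refine ⟨⟨α.toFinset, α, β⟩, ?_, rfl⟩
    simp only [Finset.mem_sigma, Finset.mem_powerset, Finset.mem_product, mem_arrangements]
    refine ⟨fun x hx => ?_, ⟨hl.1, trivial⟩, hl.2.1.2, ?_⟩
    · rw [List.mem_toFinset] at hx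
      grind
    · ext x
      simp only [List.mem_toFinset, Finset.mem_sdiff]
      grind

theorem sum_perm_word {M : Type*} [AddCommMonoid M] (n : ℕ) (F : List ℕ → M) :
    ∑ σ : Equiv.Perm (Fin n), F (word σ) = ∑ l ∈ arrangements (Finset.Icc 1 n), F l := by
  have hword : ∀ σ : Equiv.Perm (Fin n), word σ ∈ arrangements (Finset.Icc 1 n) := fun σ => by
    rw [mem_arrangements]
    constructor
    · rw [word, List.nodup_ofFn]
      intro i j h
      exact σ.injective (Fin.ext (by simpa using h))
    · ext x
      simp only [word, List.mem_toFinset, List.mem_ofFn, Finset.mem_Icc]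
      constructor
      · rintro ⟨i, rfl⟩
        have := (σ i).isLt
        omega
      · rintro ⟨h1, h2⟩
        refine ⟨σ.symm ⟨x - 1, by omega⟩, ?_⟩
        simp
        omega
  refine Finset.sum_bij (fun σ _ => word σ) (fun σ _ => hword σ) ?_ ?_ fun _ _ => rfl
  · intro σ _ τ _ h
    ext i
    have := congrFun (List.ofFn_injective h) i
    simpa using this
  · intro l hl
    have hlen : l.length = n := by simpa using length_of_mem_arrangements hl
    have hmem : ∀ i : Fin n, 1 ≤ l[i] ∧ l[i] ≤ n := fun i =>
      Finset.mem_Icc.1 ((mem_of_mem_arrangements hl).1 (List.getElem_mem _))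
    let f : Fin n → Fin n := fun i => ⟨l[i] - 1, by have := hmem i; omega⟩
    have hf : Function.Injective f := fun i j h => by
      have h1 := hmem i
      have h2 := hmem j
      have h3 : l[i] - 1 = l[j] - 1 := congrArg Fin.val h
      have h4 : l[(i : ℕ)] = l[(j : ℕ)] := by
        change l[i] = l[j]
        omega
      exact Fin.ext ((mem_arrangements.1 hl).1.getElem_inj_iff.1 h4)
    refine ⟨Equiv.ofBijective f (Finite.injective_iff_bijective.1 hf), Finset.mem_univ _, ?_⟩
    refine List.ext_getElem (by simp [word, hlen]) fun i h1 h2 => ?_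
    have := (hmem ⟨i, by omega⟩).1
    simp only [word, List.getElem_ofFn, Equiv.ofBijective_apply, f]
    exact Nat.sub_add_cancel this

/-- The sequence whose exponential generating function `f` satisfies `f(0) = 0` and
`f' = 1 + (1 + X) f + X f²`. For `n ≥ 1` its `n`-th term is the `n`-th Eulerian polynomial. -/
noncomputable def eulerianSeq : ℕ → ℤ[X]
  | 0 => 0
  | n + 1 => X * ∑ m : Fin (n + 1), n.choose m • (eulerianSeq m * eulerianSeq (n - m))
      + (1 + X) * eulerianSeq n + if n = 0 then 1 else 0
termination_by n => n
decreasing_by all_goals omega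

theorem eulerianSeq_card_insert {A : Finset ℕ} {N : ℕ} (hN : N ∉ A) :
    eulerianSeq (insert N A).card =
      X * ∑ S ∈ A.powerset, eulerianSeq S.card * eulerianSeq (A \ S).card
        + (1 + X) * eulerianSeq A.card + if A = ∅ then 1 else 0 := by
  rw [Finset.card_insert_of_notMem hN, eulerianSeq,
    Fin.sum_univ_eq_sum_range
      (fun m => A.card.choose m • (eulerianSeq m * eulerianSeq (A.card - m))),
    ← Finset.sum_powerset_apply_card (fun m => eulerianSeq m * eulerianSeq (A.card - m))]
  simp only [Finset.card_eq_zero]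
  congr 3
  refine Finset.sum_congr rfl fun S hS => ?_
  rw [Finset.card_sdiff_of_subset (Finset.mem_powerset.1 hS)]

theorem Finset.induction_on_insert_max {P : Finset ℕ → Prop} (A : Finset ℕ) (empty : P ∅)
    (insert : ∀ (N : ℕ) (A : Finset ℕ), (∀ a ∈ A, a < N) → (∀ B, B.card ≤ A.card → P B) →
      P (insert N A)) : P A := by
  induction h : A.card using Nat.strong_induction_on generalizing A with
  | _ n ih =>
    subst h
    rcases A.eq_empty_or_nonempty with rfl | hA
    · exact empty
    · rw [← Finset.insert_erase (A.max'_mem hA)]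
      refine insert _ _ (fun a ha => A.lt_max'_of_mem_erase_max' hA ha) fun B hB => ?_
      refine ih _ (hB.trans_lt (Finset.card_erase_lt_of_mem (A.max'_mem hA))) B rfl

theorem sum_arrangements_eq_eulerianSeq {F : List ℕ → ℤ[X]} {u v : ℤ[X]} (huv : u + v = 1 + X)
    (hnil : F [] = 0)
    (hF : ∀ (α β : List ℕ) (N : ℕ), (∀ a ∈ α, a < N) → (∀ b ∈ β, b < N) →
      F (α ++ N :: β) = X * (F α * F β) + (if α = [] then u * F β else 0)
        + (if β = [] then v * F α else 0) + if α = [] ∧ β = [] then 1 else 0)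
    (A : Finset ℕ) : ∑ l ∈ arrangements A, F l = eulerianSeq A.card := by
  induction A using Finset.induction_on_insert_max with
  | empty => simp [arrangements_empty, hnil, eulerianSeq]
  | insert N A hA ih =>
    have hN : N ∉ A := fun h => lt_irrefl _ (hA N h)
    have hsplit : ∀ S ∈ A.powerset,
        ∑ α ∈ arrangements S, ∑ β ∈ arrangements (A \ S), F (α ++ N :: β) =
          X * (eulerianSeq S.card * eulerianSeq (A \ S).card)
            + (if S = ∅ then u * eulerianSeq A.card else 0)
            + (if S = A then v * eulerianSeq A.card else 0)
            + if S = ∅ then (if A = ∅ then 1 else 0) else 0 := by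
      intro S hS
      rw [Finset.mem_powerset] at hS
      have h1 : ∀ α ∈ arrangements S, ∀ β ∈ arrangements (A \ S),
          F (α ++ N :: β) = X * (F α * F β) + (if S = ∅ then u * F β else 0)
            + (if S = A then v * F α else 0) + if S = ∅ ∧ S = A then 1 else 0 := by
        intro α hα β hβ
        have hSA : A \ S = ∅ ↔ S = A := by
          rw [Finset.sdiff_eq_empty_iff_subset]
          exact ⟨hS.antisymm, fun h => h.ge⟩
        rw [hF α β N (fun a ha => hA a (hS ((mem_of_mem_arrangements hα).1 ha)))
          (fun b hb => hA b (Finset.sdiff_subset ((mem_of_mem_arrangements hβ).1 hb)))]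
        simp only [eq_nil_iff_of_mem_arrangements hα, eq_nil_iff_of_mem_arrangements hβ, hSA]
      rw [Finset.sum_congr rfl fun α hα => Finset.sum_congr rfl (h1 α hα),
        ← ih S (Finset.card_le_card hS), ← ih (A \ S) (Finset.card_le_card Finset.sdiff_subset),
        ← ih A le_rfl]
      simp only [Finset.sum_add_distrib, Finset.sum_mul_sum, ← Finset.mul_sum]
      congr 1
      · congr 1
        · congr 1
          by_cases h : S = ∅
          · subst h
            simp [arrangements_empty, Finset.mul_sum]
          · simp [h]
        · by_cases h : S = A
          · subst h
            simp [arrangements_empty, Finset.mul_sum]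
          · simp [h]
      · by_cases h : S = ∅
        · subst h
          by_cases h' : A = ∅
          · subst h'
            simp [arrangements_empty]
          · simp [Ne.symm h', h']
        · simp [h]
    rw [sum_arrangements_insert hN, Finset.sum_congr rfl hsplit, eulerianSeq_card_insert hN, ← huv]
    simp only [Finset.sum_add_distrib, Finset.sum_ite_eq', Finset.empty_mem_powerset,
      Finset.mem_powerset_self, if_true, ← Finset.mul_sum]
    ring

/-- The weight `X ^ des`, set to `0` on the empty word. -/
noncomputable def desWeight (l : List ℕ) : ℤ[X] :=
  if l = [] then 0 else X ^ adjCount (· > ·) l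

open Classical in
/-- The weight `X ^ asc * (1 + X) ^ dd` on nonempty words without double ascents, where
`dd = length - 1 - 2 * asc` is the number of double descents of such a word. -/
noncomputable def gammaWeight (l : List ℕ) : ℤ[X] :=
  if l ≠ [] ∧ NoDoubleAscent l then
    X ^ adjCount (· < ·) l * (1 + X) ^ (l.length - 1 - 2 * adjCount (· < ·) l)
  else 0

theorem gammaWeight_of_noDoubleAscent {l : List ℕ} (hl : l ≠ []) (h : NoDoubleAscent l) :
    gammaWeight l =
      X ^ adjCount (· < ·) l * (1 + X) ^ (l.length - 1 - 2 * adjCount (· < ·) l) :=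
  if_pos ⟨hl, h⟩

theorem gammaWeight_of_not_noDoubleAscent {l : List ℕ} (h : ¬ NoDoubleAscent l) :
    gammaWeight l = 0 :=
  if_neg fun h' => h h'.2

theorem gammaWeight_nil : gammaWeight [] = 0 :=
  if_neg fun h => h.1 rfl

theorem desWeight_append_cons {α β : List ℕ} {N : ℕ} (hα : ∀ a ∈ α, a < N) (hβ : ∀ b ∈ β, b < N) :
    desWeight (α ++ N :: β) = X * (desWeight α * desWeight β)
      + (if α = [] then X * desWeight β else 0) + (if β = [] then 1 * desWeight α else 0)
      + if α = [] ∧ β = [] then 1 else 0 := by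
  simp only [desWeight, adjCount_gt_append_cons hα hβ]
  by_cases h1 : α = [] <;> by_cases h2 : β = [] <;> simp [h1, h2, adjCount] <;> ring

theorem gammaWeight_append_cons {α β : List ℕ} {N : ℕ} (hα : ∀ a ∈ α, a < N)
    (hβ : ∀ b ∈ β, b < N) :
    gammaWeight (α ++ N :: β) = X * (gammaWeight α * gammaWeight β)
      + (if α = [] then (1 + X) * gammaWeight β else 0) + (if β = [] then 0 * gammaWeight α else 0)
      + if α = [] ∧ β = [] then 1 else 0 := by
  have hne : α ++ N :: β ≠ [] := by simp
  have hsplit := noDoubleAscent_append_cons hα hβ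
  by_cases h1 : α = []
  · subst h1
    by_cases h2 : β = []
    · subst h2
      rw [gammaWeight_nil, gammaWeight_of_noDoubleAscent hne (by simp [NoDoubleAscent])]
      simp [adjCount]
    by_cases hd : NoDoubleAscent β
    · obtain ⟨k, hk⟩ := Nat.exists_eq_add_of_lt (hd.two_mul_adjCount_lt h2)
      rw [gammaWeight_nil, gammaWeight_of_noDoubleAscent h2 hd, gammaWeight_of_noDoubleAscent hne
        (hsplit.2 ⟨trivial, hd, fun _ => rfl⟩), adjCount_lt_append_cons hα hβ]
      simp only [List.nil_append, List.length_cons, hk, h2, adjCount, if_true, if_false]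
      rw [show 2 * adjCount (· < ·) β + k + 1 + 1 - 1 - 2 * (0 + adjCount (· < ·) β + 0) = k + 1 by
          omega,
        show 2 * adjCount (· < ·) β + k + 1 - 1 - 2 * adjCount (· < ·) β = k by omega]
      simp
      ring
    · rw [gammaWeight_nil, gammaWeight_of_not_noDoubleAscent hd,
        gammaWeight_of_not_noDoubleAscent fun h => hd (hsplit.1 h).2.1]
      simp [h2]
  by_cases h2 : β = []
  · subst h2
    rw [gammaWeight_nil, gammaWeight_of_not_noDoubleAscent fun h => h1 ((hsplit.1 h).2.2 rfl)]
    simp [h1]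
  by_cases hd : NoDoubleAscent α ∧ NoDoubleAscent β
  · obtain ⟨hc, hd⟩ := hd
    obtain ⟨j, hj⟩ := Nat.exists_eq_add_of_lt (hc.two_mul_adjCount_lt h1)
    obtain ⟨k, hk⟩ := Nat.exists_eq_add_of_lt (hd.two_mul_adjCount_lt h2)
    rw [gammaWeight_of_noDoubleAscent h1 hc, gammaWeight_of_noDoubleAscent h2 hd,
      gammaWeight_of_noDoubleAscent hne (hsplit.2 ⟨hc, hd, fun h => absurd h h2⟩),
      adjCount_lt_append_cons hα hβ]
    simp only [List.length_append, List.length_cons, hj, hk, h1, h2, if_false, false_and]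
    rw [show 2 * adjCount (· < ·) α + j + 1 + (2 * adjCount (· < ·) β + k + 1 + 1) - 1 -
        2 * (adjCount (· < ·) α + adjCount (· < ·) β + 1) = j + k by omega,
      show 2 * adjCount (· < ·) α + j + 1 - 1 - 2 * adjCount (· < ·) α = j by omega,
      show 2 * adjCount (· < ·) β + k + 1 - 1 - 2 * adjCount (· < ·) β = k by omega]
    ring
  · rw [gammaWeight_of_not_noDoubleAscent fun h => hd ⟨(hsplit.1 h).1, (hsplit.1 h).2.1⟩]
    rcases not_and_or.1 hd with hd | hd <;> simp [gammaWeight_of_not_noDoubleAscent hd, h1, h2]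

theorem sum_desWeight (A : Finset ℕ) :
    ∑ l ∈ arrangements A, desWeight l = eulerianSeq A.card :=
  sum_arrangements_eq_eulerianSeq (add_comm _ _) (by simp [desWeight])
    (fun _ _ _ => desWeight_append_cons) A

theorem sum_gammaWeight (A : Finset ℕ) :
    ∑ l ∈ arrangements A, gammaWeight l = eulerianSeq A.card :=
  sum_arrangements_eq_eulerianSeq (add_zero _) gammaWeight_nil
    (fun _ _ _ => gammaWeight_append_cons) A

/-- The binomial transform `1 + X * ∑_{S ⊆ A} f(|S|)` of the Eulerian sequence. -/
noncomputable def binomialEulerian (A : Finset ℕ) : ℤ[X] :=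
  1 + X * ∑ S ∈ A.powerset, eulerianSeq S.card

theorem sum_powerset_powerset_sdiff {M : Type*} [AddCommMonoid M] (A : Finset ℕ)
    (F : Finset ℕ → Finset ℕ → M) :
    ∑ S ∈ A.powerset, ∑ T ∈ S.powerset, F T (S \ T) =
      ∑ S ∈ A.powerset, ∑ T ∈ S.powerset, F T (A \ S) := by
  rw [Finset.sum_sigma', Finset.sum_sigma']
  refine Finset.sum_bij' (fun x _ => ⟨x.2 ∪ A \ x.1, x.2⟩) (fun x _ => ⟨x.2 ∪ A \ x.1, x.2⟩)
    ?_ ?_ ?_ ?_ ?_ <;> rintro ⟨S, T⟩ hx <;>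
    simp only [Finset.mem_sigma, Finset.mem_powerset] at hx ⊢
  · exact ⟨Finset.union_subset (hx.2.trans hx.1) Finset.sdiff_subset, Finset.subset_union_left⟩
  · exact ⟨Finset.union_subset (hx.2.trans hx.1) Finset.sdiff_subset, Finset.subset_union_left⟩
  · congr 1
    ext a
    have := @hx.1 a
    have := @hx.2 a
    simp only [Finset.mem_union, Finset.mem_sdiff]
    tauto
  · congr 1
    ext a
    have := @hx.1 a
    have := @hx.2 a
    simp only [Finset.mem_union, Finset.mem_sdiff]
    tauto
  · congr 1
    ext a
    have := @hx.1 a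
    have := @hx.2 a
    simp only [Finset.mem_union, Finset.mem_sdiff]
    tauto

theorem binomialEulerian_insert {A : Finset ℕ} {N : ℕ} (hN : N ∉ A) :
    binomialEulerian (insert N A) = (1 + X) * binomialEulerian A
      + X * ∑ S ∈ A.powerset, binomialEulerian S * eulerianSeq (A \ S).card := by
  have h1 : ∀ S ∈ A.powerset, eulerianSeq (insert N S).card = _ := fun S hS =>
    eulerianSeq_card_insert fun h => hN (Finset.mem_powerset.1 hS h)
  have h2 : ∑ S ∈ A.powerset, eulerianSeq (A \ S).card = ∑ S ∈ A.powerset, eulerianSeq S.card :=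
    Finset.sum_bij' (fun S _ => A \ S) (fun S _ => A \ S) (by simp) (by simp)
      (fun S hS => Finset.sdiff_sdiff_eq_self (Finset.mem_powerset.1 hS))
      (fun S hS => Finset.sdiff_sdiff_eq_self (Finset.mem_powerset.1 hS)) fun _ _ => rfl
  have h3 : ∀ S ∈ A.powerset, binomialEulerian S * eulerianSeq (A \ S).card =
      eulerianSeq (A \ S).card
        + X * ∑ T ∈ S.powerset, eulerianSeq T.card * eulerianSeq (A \ S).card := fun S _ => by
    rw [binomialEulerian, ← Finset.sum_mul]
    ring
  rw [Finset.sum_congr rfl h3, Finset.sum_add_distrib, h2, ← Finset.mul_sum,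
    ← sum_powerset_powerset_sdiff A fun S T => eulerianSeq S.card * eulerianSeq T.card,
    binomialEulerian, Finset.sum_powerset_insert hN, Finset.sum_congr rfl h1, binomialEulerian]
  simp only [Finset.sum_add_distrib, Finset.sum_ite_eq', Finset.empty_mem_powerset, if_true,
    ← Finset.mul_sum]
  ring

open Classical in
/-- The weight `gammaWeight`, restricted to words whose first ascent occurs at the letter `1`. -/
noncomputable def firstAscentWeight (l : List ℕ) : ℤ[X] :=
  if FirstAscentAtOne l then gammaWeight l else 0

theorem firstAscentWeight_cons {β : List ℕ} {N : ℕ} (hβ : ∀ b ∈ β, b < N) (hne : β ≠ []) :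
    firstAscentWeight (N :: β) = (1 + X) * firstAscentWeight β := by
  have h := gammaWeight_append_cons (α := []) (by simp) hβ
  rw [List.nil_append, gammaWeight_nil] at h
  have hcons := firstAscentAtOne_cons hβ
  by_cases hf : FirstAscentAtOne β
  · rw [firstAscentWeight, firstAscentWeight, if_pos hf, if_pos (hcons.2 hf), h]
    simp [hne]
  · rw [firstAscentWeight, firstAscentWeight, if_neg hf, if_neg (mt hcons.1 hf), mul_zero]

theorem firstAscentWeight_append_cons {α β : List ℕ} {N : ℕ} (hα : ∀ a ∈ α, 1 ≤ a ∧ a < N)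
    (hβ : ∀ b ∈ β, b < N) (hne : α ≠ []) :
    firstAscentWeight (α ++ N :: β) =
      if 1 ∈ α then X * (firstAscentWeight α * gammaWeight β) else 0 := by
  have h := gammaWeight_append_cons (fun a ha => (hα a ha).2) hβ
  have hsplit := firstAscentAtOne_append_cons (β := β) hα hne
  by_cases hf : FirstAscentAtOne α ∧ 1 ∈ α
  · rw [firstAscentWeight, firstAscentWeight, if_pos (hsplit.2 hf), if_pos hf.1, if_pos hf.2, h]
    simp [hne]
  · rw [firstAscentWeight, firstAscentWeight, if_neg (mt hsplit.1 hf)]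
    rcases not_and_or.1 hf with hf | hf <;> simp [hf]

theorem sum_firstAscentWeight (A : Finset ℕ) (hA : ∀ a ∈ A, 1 < a) :
    ∑ l ∈ arrangements (insert 1 A), firstAscentWeight l = binomialEulerian A := by
  induction A using Finset.induction_on_insert_max with
  | empty =>
    have : FirstAscentAtOne [1] := trivial
    rw [insert_empty_eq, arrangements_singleton, Finset.sum_singleton, firstAscentWeight,
      if_pos this, gammaWeight_of_noDoubleAscent (by simp) (by simp [NoDoubleAscent])]
    simp [binomialEulerian, adjCount, eulerianSeq]
  | insert N A hlt ih =>
    have hN : N ∉ A := fun h => lt_irrefl _ (hlt N h)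
    have hN1 : 1 < N := hA N (Finset.mem_insert_self _ _)
    have hA' : ∀ a ∈ A, 1 < a := fun a ha => hA a (Finset.mem_insert_of_mem ha)
    have h1A : 1 ∉ A := fun h => lt_irrefl _ (hA' 1 h)
    have hmem : ∀ a ∈ insert 1 A, 1 ≤ a ∧ a < N := by
      intro a ha
      rcases Finset.mem_insert.1 ha with rfl | ha
      · exact ⟨le_rfl, hN1⟩
      · exact ⟨(hA' a ha).le, hlt a ha⟩
    have hlt' : ∀ S ⊆ insert 1 A, ∀ β ∈ arrangements S, ∀ b ∈ β, 1 ≤ b ∧ b < N :=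
      fun S hS β hβ b hb => hmem b (hS ((mem_of_mem_arrangements hβ).1 hb))
    have hwithout : ∀ S ∈ A.powerset, ∑ α ∈ arrangements S,
        ∑ β ∈ arrangements (insert 1 A \ S), firstAscentWeight (α ++ N :: β) =
          if S = ∅ then (1 + X) * binomialEulerian A else 0 := by
      intro S hS
      rw [Finset.mem_powerset] at hS
      split_ifs with h
      · subst h
        rw [arrangements_empty, Finset.sum_singleton, Finset.sdiff_empty, ← ih A le_rfl hA',
          Finset.mul_sum]
        refine Finset.sum_congr rfl fun β hβ => ?_
        refine firstAscentWeight_cons (fun b hb => (hlt' _ subset_rfl β hβ b hb).2) fun h => ?_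
        simp [eq_nil_iff_of_mem_arrangements hβ] at h
      · refine Finset.sum_eq_zero fun α hα => Finset.sum_eq_zero fun β hβ => ?_
        rw [firstAscentWeight_append_cons (hlt' _ (hS.trans (Finset.subset_insert _ _)) α hα)
          (fun b hb => (hlt' _ Finset.sdiff_subset β hβ b hb).2)
          (mt (eq_nil_iff_of_mem_arrangements hα).1 h), if_neg]
        exact fun h1 => h1A (hS ((mem_of_mem_arrangements hα).1 h1))
    have hwith : ∀ S ∈ A.powerset, ∑ α ∈ arrangements (insert 1 S),
        ∑ β ∈ arrangements (insert 1 A \ insert 1 S), firstAscentWeight (α ++ N :: β) =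
          X * (binomialEulerian S * eulerianSeq (A \ S).card) := by
      intro S hS
      rw [Finset.mem_powerset] at hS
      have hsd : insert 1 A \ insert 1 S = A \ S := by
        ext a
        simp only [Finset.mem_sdiff, Finset.mem_insert]
        grind
      rw [hsd, ← ih S (Finset.card_le_card hS) fun a ha => hA' a (hS ha), ← sum_gammaWeight,
        Finset.sum_mul_sum, Finset.mul_sum]
      refine Finset.sum_congr rfl fun α hα => ?_
      rw [Finset.mul_sum]
      refine Finset.sum_congr rfl fun β hβ => ?_
      rw [firstAscentWeight_append_cons (hlt' _ (Finset.insert_subset_insert _ hS) α hα)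
        (fun b hb => (hlt' _ (Finset.sdiff_subset.trans (Finset.subset_insert _ _)) β hβ b hb).2)
        (mt (eq_nil_iff_of_mem_arrangements hα).1 (Finset.insert_ne_empty _ _)), if_pos]
      exact (mem_of_mem_arrangements hα).2 (Finset.mem_insert_self _ _)
    rw [Finset.insert_comm, sum_arrangements_insert (by simp [hN, hN1.ne']),
      Finset.sum_powerset_insert h1A, Finset.sum_congr rfl hwithout, Finset.sum_congr rfl hwith,
      binomialEulerian_insert hN]
    simp only [Finset.sum_ite_eq', Finset.empty_mem_powerset, if_true, ← Finset.mul_sum]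

theorem binomialEulerian_eq_sum_perm {A : Finset ℕ} {n : ℕ} (hA : A.card = n) :
    binomialEulerian A = 1 + X * ∑ m ∈ Finset.Icc 1 n, (n.choose m : ℤ[X]) *
      ∑ σ : Equiv.Perm (Fin m), X ^ desW (word σ) := by
  rw [binomialEulerian, Finset.sum_powerset_apply_card, hA, Finset.range_eq_Ico,
    Finset.sum_eq_sum_Ico_succ_bot (Nat.succ_pos n), eulerianSeq, smul_zero, zero_add,
    ← Finset.Ico_add_one_right_eq_Icc]
  congr 2
  refine Finset.sum_congr rfl fun m hm => ?_
  rw [nsmul_eq_mul, sum_perm_word m fun l => X ^ desW l,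
    show eulerianSeq m = eulerianSeq (Finset.Icc 1 m).card by simp, ← sum_desWeight]
  congr 1
  refine Finset.sum_congr rfl fun l hl => ?_
  have hne : l ≠ [] := by
    rw [Ne, eq_nil_iff_of_mem_arrangements hl, Finset.Icc_eq_empty_iff]
    simp at hm
    omega
  rw [desWeight, if_neg hne, desW_eq_adjCount]

theorem firstAscentWeight_word {n : ℕ} (σ : Equiv.Perm (Fin (n + 1))) :
    firstAscentWeight (word σ) = if isPRW (word σ) ∧ daW (word σ) = 0 then
      X ^ ascW (word σ) * (1 + X) ^ (n - 2 * ascW (word σ)) else 0 := by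
  have hlen : (word σ).length = n + 1 := by simp [word]
  have hda := daW_eq_zero_iff (w := word σ) fun a ha => by
    rw [hlen]
    obtain ⟨i, rfl⟩ := List.mem_ofFn.1 ha
    exact (σ i).isLt
  have hne : word σ ≠ [] := List.ne_nil_of_length_eq_add_one hlen
  rw [firstAscentWeight]
  by_cases h1 : isPRW (word σ)
  · rw [if_pos ((isPRW_iff _).1 h1)]
    by_cases h2 : daW (word σ) = 0
    · rw [if_pos ⟨h1, h2⟩, gammaWeight_of_noDoubleAscent hne (hda.1 h2), hlen, ascW_eq_adjCount,
        Nat.add_sub_cancel]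
    · rw [if_neg fun h => h2 h.2, gammaWeight_of_not_noDoubleAscent (mt hda.2 h2)]
  · rw [if_neg (mt (isPRW_iff _).2 h1), if_neg fun h => h1 h.1]

theorem two_mul_ascW_le {n : ℕ} (σ : Equiv.Perm (Fin (n + 1))) (h : daW (word σ) = 0) :
    2 * ascW (word σ) ≤ n := by
  have hlen : (word σ).length = n + 1 := by simp [word]
  rw [daW_eq_zero_iff fun a ha => ?_] at h
  · have := h.two_mul_adjCount_lt (List.ne_nil_of_length_eq_add_one hlen)
    rw [ascW_eq_adjCount]
    omega
  · rw [hlen]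
    obtain ⟨i, rfl⟩ := List.mem_ofFn.1 ha
    exact (σ i).isLt

/-- Postnikov–Reiner–Williams: the `γ`-positivity expansion of the
binomial-Eulerian polynomial, where `γ̃_{n,k}` counts permutations in `PRW_{n+1}` with
`k` ascents and no double ascents. -/
theorem binomialEulerian_gamma_positivity (n : ℕ) (hn : 1 ≤ n) :
    ((1 : Polynomial ℤ) + Polynomial.X *
        ∑ m ∈ Finset.Icc 1 n, (n.choose m : Polynomial ℤ) *
          ∑ σ : Equiv.Perm (Fin m), Polynomial.X ^ desW (word σ))
      = ∑ k ∈ Finset.range (n / 2 + 1),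
          (((PRW (n + 1)).filter
              (fun σ => ascW (word σ) = k ∧ daW (word σ) = 0)).card : Polynomial ℤ) *
            Polynomial.X ^ k * (1 + Polynomial.X) ^ (n - 2 * k) := by
  have hcard : (Finset.Icc 2 (n + 1)).card = n := by simp
  have hIcc : Finset.Icc 1 (n + 1) = insert 1 (Finset.Icc 2 (n + 1)) := by
    ext a
    simp only [Finset.mem_Icc, Finset.mem_insert]
    omega
  rw [← binomialEulerian_eq_sum_perm hcard,
    ← sum_firstAscentWeight _ (fun a ha => (Finset.mem_Icc.1 ha).1), ← hIcc, ← sum_perm_word]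
  simp only [firstAscentWeight_word]
  rw [← Finset.sum_filter, ← Finset.sum_fiberwise_of_maps_to (t := Finset.range (n / 2 + 1))
    (g := fun σ => ascW (word σ))]
  · refine Finset.sum_congr rfl fun k _ => ?_
    rw [mul_assoc, ← nsmul_eq_mul, ← Finset.sum_const, PRW]
    refine Finset.sum_congr ?_ fun σ hσ => ?_
    · ext σ
      simp only [Finset.mem_filter, Finset.mem_univ, true_and]
      tauto
    · rw [(Finset.mem_filter.1 hσ).2.1]
  · intro σ hσ
    have := two_mul_ascW_le σ (Finset.mem_filter.1 hσ).2.2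
    rw [Finset.mem_range]
    omega
end

section
/- Let n ≥ 1 and let x, y, u_1, u_2, u_3, u_4, α be elements of a commutative ring satisfying x + y = u_3 + u_4 and x·y = u_1·u_2. Then ∑_{σ∈S_{n+1}} x^{des(σ)} y^{asc(σ)} α^{LRmin(σ)+RLmin(σ)−2} = ∑_{σ∈S_{n+1}} (u_1 u_2)^{M(σ)} u_3^{da(σ)} u_4^{dd(σ)} α^{LRmin(σ)+RLmin(σ)−2}. -/
/-- The weight of a letter, given whether it is entered and left by an ascent:
`p` for a peak, `u` for a double ascent, `v` for a double descent and `1` for a valley. -/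
def turnWeight {A : Type*} [CommRing A] (p u v : A) : Bool → Bool → A
  | true, true => u
  | true, false => p
  | false, true => 1
  | false, false => v

/-- The product of the weights of the letters of a word which is entered by an ascent or a
descent, according to the Boolean, and left by an ascent. -/
def runWeight {A : Type*} [CommRing A] (p u v : A) : Bool → List ℕ → A
  | _, [] => 1
  | b, [_] => turnWeight p u v b true
  | b, a :: c :: l => turnWeight p u v b (a < c) * runWeight p u v (a < c) (c :: l)

/-- The number of right-to-left minima of a word other than its last letter. -/
def suffixMins : List ℕ → ℕ
  | [] => 0
  | [_] => 0
  | a :: b :: l => (if ∀ c ∈ b :: l, a < c then 1 else 0) + suffixMins (b :: l)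

/-- The number of letters smaller than everything to their left, when the word is preceded by
the letters of the first list. -/
def prefixMins : List ℕ → List ℕ → ℕ
  | _, [] => 0
  | s, a :: l => (if ∀ c ∈ s, a < c then 1 else 0) + prefixMins (a :: s) l

/-- The weight of a word: `p`, `u`, `v` mark its peaks, double ascents and double descents, and
`t` its left-to-right and right-to-left minima other than the first and the last letter. -/
def wordWeight {A : Type*} [CommRing A] (p u v t : A) : List ℕ → A
  | [] => 1
  | a :: l => runWeight p u v false (a :: l) * t ^ (prefixMins [a] l + suffixMins (a :: l))

section Insertion

variable {K A : Type*} [CommRing K] [CommRing A] [Algebra K A] {p u v t : A} {m : ℕ}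

theorem prefixMins_congr {s s' : List ℕ} {l : List ℕ}
    (h : ∀ a ∈ l, (∀ c ∈ s, a < c) ↔ ∀ c ∈ s', a < c) : prefixMins s l = prefixMins s' l := by
  induction l generalizing s s' with
  | nil => rfl
  | cons a l ih =>
    simp only [prefixMins, h a (by simp)]
    congr 1
    exact ih fun b hb => by simp [h b (by simp [hb])]

theorem prefixMins_cons_of_lt {s l : List ℕ} (h : ∀ a ∈ l, a < m) :
    prefixMins (m :: s) l = prefixMins s l :=
  prefixMins_congr fun a ha => by simp [h a ha]

theorem prefixMins_of_mem_permutations'Aux {s l z : List ℕ} (hl : ∀ a ∈ l, a < m)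
    (hs : ∃ a ∈ s, a < m) (hz : z ∈ l.permutations'Aux m) :
    prefixMins s z = prefixMins s l := by
  have hm : ∀ (s l : List ℕ), (∃ a ∈ s, a < m) → (∀ a ∈ l, a < m) →
      prefixMins s (m :: l) = prefixMins s l := by
    intro s l ⟨a, ha, ham⟩ hl
    have : ¬ ∀ c ∈ s, m < c := fun h => absurd (h a ha) (by omega)
    rw [prefixMins, if_neg this, zero_add, prefixMins_cons_of_lt hl]
  induction l generalizing s z with
  | nil =>
    simp only [List.permutations'Aux, List.mem_singleton] at hz
    subst hz
    exact hm s [] hs hl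
  | cons b l ih =>
    simp only [List.permutations'Aux, List.mem_cons, List.mem_map] at hz
    rcases hz with rfl | ⟨z, hz, rfl⟩
    · exact hm s _ hs hl
    · obtain ⟨a, ha, ham⟩ := hs
      rw [prefixMins, prefixMins, ih (fun c hc => hl c (by simp [hc])) ⟨a, by simp [ha], ham⟩ hz]

theorem mem_permutations'Aux_perm {l z : List ℕ} (hz : z ∈ l.permutations'Aux m) :
    z.Perm (m :: l) := by
  have : z ∈ (m :: l).permutations' := by
    rw [List.permutations', List.mem_flatMap]
    exact ⟨l, List.mem_permutations'.2 (List.Perm.refl l), hz⟩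
  exact List.mem_permutations'.1 this

/-- Inserting a new largest letter somewhere behind the first letter of a word acts on
`runWeight` as a derivation, up to the contributions of the two extremal slots. -/
theorem sum_runWeight_permutations'Aux (D : Derivation K A A) (hp : D p = p * (u + v))
    (hu : D u = p) (hv : D v = p) (b : Bool) (a : ℕ) (l : List ℕ) (hl : ∀ c ∈ a :: l, c < m) :
    ((l.permutations'Aux m).map fun z =>
        runWeight p u v b (a :: z) * t ^ suffixMins (a :: z)).sum
      + (if b then p * runWeight p u v false (a :: l) else 0) * t ^ suffixMins (a :: l)
      = (D (runWeight p u v b (a :: l)) + t * u * runWeight p u v b (a :: l))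
          * t ^ suffixMins (a :: l) := by
  induction l generalizing a b with
  | nil =>
    have ham : a < m := hl a (by simp)
    cases b <;> simp [runWeight, suffixMins, turnWeight, ham, hu] <;> ring
  | cons c l ih =>
    have ham : a < m := hl a (by simp)
    have hcm : c < m := hl c (by simp)
    have key : ((l.permutations'Aux m).map fun z =>
        runWeight p u v b (a :: c :: z) * t ^ suffixMins (a :: c :: z)).sum =
        turnWeight p u v b (a < c) * t ^ (if ∀ d ∈ c :: l, a < d then 1 else 0) *
        ((l.permutations'Aux m).map fun z =>
        runWeight p u v (a < c) (c :: z) * t ^ suffixMins (c :: z)).sum := by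
      rw [← List.sum_map_mul_left]
      congr 1
      refine List.map_congr_left fun z hz => ?_
      have : (∀ d ∈ c :: z, a < d) ↔ ∀ d ∈ c :: l, a < d := by
        simp [(mem_permutations'Aux_perm hz).mem_iff, ham]
      rw [runWeight, suffixMins, pow_add]
      simp only [this]
      ring
    have hsm : suffixMins (a :: m :: c :: l) = suffixMins (a :: c :: l) := by
      have h1 : ¬ ∀ d ∈ c :: l, m < d := fun h => absurd (h c (by simp)) (by omega)
      have h2 : (∀ d ∈ m :: c :: l, a < d) ↔ ∀ d ∈ c :: l, a < d := by simp [ham]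
      rw [suffixMins, suffixMins, if_neg h1, zero_add, suffixMins]
      simp only [h2]
    have IH := ih (a < c) c fun d hd => hl d (by simp at hd ⊢; tauto)
    simp only [List.permutations'Aux, List.map_cons, List.sum_cons, List.map_map,
      Function.comp_def]
    rw [key, hsm, eq_sub_of_add_eq IH, suffixMins, pow_add]
    have hmc : ¬ m < c := by omega
    generalize (if ∀ d ∈ c :: l, a < d then 1 else 0) = k
    by_cases hac : a < c <;> cases b <;>
      simp [runWeight, turnWeight, ham, hac, hmc, hu, hv, hp] <;> ring

theorem sum_wordWeight_permutations'Aux (D : Derivation K A A) (hp : D p = p * (u + v))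
    (hu : D u = p) (hv : D v = p) (ht : D t = 0) {w : List ℕ} (hw : w ≠ [])
    (hl : ∀ c ∈ w, c < m) :
    ((w.permutations'Aux m).map (wordWeight p u v t)).sum
      = t * (u + v) * wordWeight p u v t w + D (wordWeight p u v t w) := by
  obtain _ | ⟨a, l⟩ := w
  · exact absurd rfl hw
  have ham : a < m := hl a (by simp)
  have key : ((l.permutations'Aux m).map fun z => wordWeight p u v t (a :: z)).sum =
      t ^ prefixMins [a] l * ((l.permutations'Aux m).map fun z =>
        runWeight p u v false (a :: z) * t ^ suffixMins (a :: z)).sum := by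
    rw [← List.sum_map_mul_left]
    congr 1
    refine List.map_congr_left fun z hz => ?_
    rw [wordWeight, prefixMins_of_mem_permutations'Aux (fun c hc => hl c (by simp [hc]))
      ⟨a, by simp, ham⟩ hz, pow_add]
    ring
  have S := sum_runWeight_permutations'Aux (t := t) D hp hu hv false a l hl
  simp only [Bool.false_eq_true, if_false, zero_mul, add_zero] at S
  have hfront : wordWeight p u v t (m :: a :: l) = t * v * wordWeight p u v t (a :: l) := by
    have h1 : ¬ ∀ c ∈ a :: l, m < c := fun h => absurd (h a (by simp)) (by omega)
    have h2 : prefixMins [a, m] l = prefixMins [a] l :=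
      prefixMins_congr fun c hc => by simp [hl c (by simp [hc])]
    have h3 : ¬ m < a := by omega
    simp [wordWeight, prefixMins, suffixMins, h2, ham, runWeight, h3, turnWeight]
    ring
  have hDt : ∀ k : ℕ, D (t ^ k) = 0 := fun k => by rw [Derivation.leibniz_pow, ht]; simp
  simp only [List.permutations'Aux, List.map_cons, List.sum_cons, List.map_map,
    Function.comp_def]
  rw [key, S, hfront, wordWeight, Derivation.leibniz, hDt, pow_add]
  simp only [smul_eq_mul]
  ring

end Insertion

/-- The word `n ⋯ 2 1`. -/
def decreasingWord : ℕ → List ℕ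
  | 0 => []
  | n + 1 => (n + 1) :: decreasingWord n

theorem mem_decreasingWord {n a : ℕ} : a ∈ decreasingWord n ↔ 1 ≤ a ∧ a ≤ n := by
  induction n with
  | zero => simp [decreasingWord]; omega
  | succ n ih => simp only [decreasingWord, List.mem_cons, ih]; omega

theorem length_decreasingWord (n : ℕ) : (decreasingWord n).length = n := by
  induction n with
  | zero => rfl
  | succ n ih => simp [decreasingWord, ih]

theorem nodup_decreasingWord (n : ℕ) : (decreasingWord n).Nodup := by
  induction n with
  | zero => simp [decreasingWord]
  | succ n ih => simp [decreasingWord, ih, mem_decreasingWord]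

theorem sum_wordWeight_permutations'_mem {K A : Type*} [CommRing K] [CommRing A] [Algebra K A]
    {p u v t : A}
    (D : Derivation K A A) (hp : D p = p * (u + v)) (hu : D u = p) (hv : D v = p)
    (ht : D t = 0) (n : ℕ) :
    ((decreasingWord (n + 1)).permutations'.map (wordWeight p u v t)).sum
      ∈ Algebra.adjoin K {p, u + v, t} := by
  set S := Algebra.adjoin K {p, u + v, t} with hS
  have hpS : p ∈ S := Algebra.subset_adjoin (by simp)
  have hsS : u + v ∈ S := Algebra.subset_adjoin (by simp)
  have htS : t ∈ S := Algebra.subset_adjoin (by simp)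
  have hD : ∀ f ∈ S, D f ∈ S := by
    intro f hf
    induction hf using Algebra.adjoin_induction with
    | mem f hf =>
      rcases hf with rfl | rfl | rfl
      · rw [hp]; exact mul_mem hpS hsS
      · rw [map_add, hu, hv]; exact add_mem hpS hpS
      · rw [ht]; exact zero_mem S
    | algebraMap r => rw [Derivation.map_algebraMap]; exact zero_mem S
    | add f g _ _ hf hg => rw [map_add]; exact add_mem hf hg
    | mul f g hfS hgS hf hg =>
      rw [Derivation.leibniz]; exact add_mem (mul_mem hfS hg) (mul_mem hgS hf)
  induction n with
  | zero => simp [decreasingWord, wordWeight, runWeight, turnWeight, prefixMins, suffixMins]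
  | succ n ih =>
    rw [decreasingWord, List.permutations', List.map_flatMap, List.flatMap, List.sum_flatten,
      List.map_map]
    have : ∀ w ∈ (decreasingWord (n + 1)).permutations',
        (List.sum ∘ fun w => (w.permutations'Aux (n + 1 + 1)).map (wordWeight p u v t)) w =
          t * (u + v) * wordWeight p u v t w + D (wordWeight p u v t w) := by
      intro w hw
      rw [List.mem_permutations'] at hw
      refine sum_wordWeight_permutations'Aux D hp hu hv ht ?_ ?_
      · rintro rfl
        simpa [decreasingWord] using hw.length_eq
      · intro c hc
        have := mem_decreasingWord.1 (hw.mem_iff.1 hc)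
        omega
    rw [List.map_congr_left this, List.sum_map_add, List.sum_map_mul_left]
    refine add_mem (mul_mem (mul_mem htS hsS) ih) ?_
    have := hD _ ih
    rwa [map_list_sum, List.map_map] at this

theorem word_perm_decreasingWord {n : ℕ} (σ : Equiv.Perm (Fin n)) :
    (word σ).Perm (decreasingWord n) := by
  rw [List.perm_ext_iff_of_nodup _ (nodup_decreasingWord n)]
  · intro a
    simp only [word, List.mem_ofFn, mem_decreasingWord]
    constructor
    · rintro ⟨i, rfl⟩
      have := (σ i).isLt
      omega
    · rintro ⟨h1, h2⟩
      refine ⟨σ.symm ⟨a - 1, by omega⟩, ?_⟩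
      simp only [Equiv.apply_symm_apply]
      omega
  · rw [word, List.nodup_ofFn]
    intro i j h
    exact σ.injective (Fin.ext (by simpa using h))

theorem word_injective {n : ℕ} : Function.Injective (word (n := n)) := by
  intro σ τ h
  have := List.ofFn_injective h
  ext i
  have := congrFun this i
  simpa using this

theorem sum_word {A : Type*} [CommRing A] (n : ℕ) (f : List ℕ → A) :
    ∑ σ : Equiv.Perm (Fin n), f (word σ) = ((decreasingWord n).permutations'.map f).sum := by
  have hnd : (decreasingWord n).permutations'.Nodup :=
    (List.permutations_perm_permutations' _).nodup_iff.1
      (List.nodup_permutations _ (nodup_decreasingWord n))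
  rw [← List.sum_toFinset f hnd]
  have himg : (Finset.univ.image (word (n := n))) = (decreasingWord n).permutations'.toFinset := by
    refine Finset.eq_of_subset_of_card_le ?_ ?_
    · intro w hw
      obtain ⟨σ, -, rfl⟩ := Finset.mem_image.1 hw
      simpa using word_perm_decreasingWord σ
    · rw [Finset.card_image_of_injective _ word_injective, List.toFinset_card_of_nodup hnd,
        ← (List.permutations_perm_permutations' _).length_eq, List.length_permutations,
        length_decreasingWord, Finset.card_univ, Fintype.card_perm, Fintype.card_fin]
  rw [← himg, Finset.sum_image fun σ _ τ _ h => word_injective h]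

/-- The entry at position `i` of the sequence `e` is smaller than those at `1, …, i - 1`. -/
abbrev IsPrefixMin (e : ℕ → ℕ) (i : ℕ) : Prop := ∀ j ∈ Finset.Icc 1 (i - 1), e i < e j

/-- The entry at position `i` of the sequence `e` is smaller than those at `i + 1, …, N`. -/
abbrev IsSuffixMin (e : ℕ → ℕ) (N i : ℕ) : Prop := ∀ j ∈ Finset.Icc (i + 1) N, e i < e j

theorem lrminW_eq_card (w : List ℕ) :
    lrminW w = ((Finset.Icc 1 w.length).filter (IsPrefixMin (wB w))).card := rfl

theorem rlminW_eq_card (w : List ℕ) :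
    rlminW w = ((Finset.Icc 1 w.length).filter (IsSuffixMin (wB w) w.length)).card := rfl

theorem suffixMins_cons (a : ℕ) {l : List ℕ} (hl : l ≠ []) :
    suffixMins (a :: l) = (if ∀ c ∈ l, a < c then 1 else 0) + suffixMins l := by
  obtain _ | ⟨b, l⟩ := l
  · exact absurd rfl hl
  · rfl

theorem runWeight_map_range' {A : Type*} [CommRing A] (p u v : A) (e : ℕ → ℕ) (k N : ℕ)
    (hN : e (k + N + 1) < e (k + N + 2)) :
    runWeight p u v (e k < e (k + 1)) ((List.range' (k + 1) (N + 1)).map e) =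
      ∏ i ∈ Finset.Ico (k + 1) (k + N + 2),
        turnWeight p u v (e (i - 1) < e i) (e i < e (i + 1)) := by
  induction N generalizing k with
  | zero => simp at hN; simp [runWeight, hN]
  | succ N ih =>
    have h := ih (k + 1) (by convert hN using 2 <;> ring)
    rw [Finset.prod_eq_prod_Ico_succ_bot (by omega)]
    rw [show k + (N + 1) + 2 = k + 1 + N + 2 by ring, ← h]
    simp [List.range'_succ, runWeight]

theorem prefixMins_map_range' (e : ℕ → ℕ) (s : List ℕ) (k N : ℕ)
    (hs : ∀ a, (∀ c ∈ s, a < c) ↔ ∀ j ∈ Finset.Icc 1 k, a < e j) :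
    prefixMins s ((List.range' (k + 1) N).map e) =
      ((Finset.Ico (k + 1) (k + 1 + N)).filter (IsPrefixMin e)).card := by
  induction N generalizing s k with
  | zero => simp [prefixMins]
  | succ N ih =>
    rw [List.range'_succ, List.map_cons, prefixMins, ih (e (k + 1) :: s) (k + 1),
      Finset.card_filter, Finset.card_filter, Finset.sum_eq_sum_Ico_succ_bot (a := k + 1) (by omega)]
    · have hk : (∀ c ∈ s, e (k + 1) < c) ↔ IsPrefixMin e (k + 1) := hs _
      simp only [hk]
      rw [show k + 1 + 1 + N = k + 1 + (N + 1) by ring]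
    · intro a
      rw [List.forall_mem_cons, hs, ← Finset.insert_Icc_right_eq_Icc_add_one (by omega),
        Finset.forall_mem_insert]

theorem suffixMins_map_range' (e : ℕ → ℕ) (k N : ℕ) :
    1 + suffixMins ((List.range' k (N + 1)).map e) =
      ((Finset.Ico k (k + N + 1)).filter (IsSuffixMin e (k + N))).card := by
  induction N generalizing k with
  | zero =>
    have : IsSuffixMin e k k := by simp [IsSuffixMin]
    simp [suffixMins, Finset.filter_singleton, if_pos this]
  | succ N ih =>
    have h := ih (k + 1)
    rw [Finset.card_filter, Finset.sum_eq_sum_Ico_succ_bot (by omega), ← Finset.card_filter,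
      show k + (N + 1) = k + 1 + N by ring, ← h]
    have hc : (∀ d ∈ (List.range' (k + 1) (N + 1)).map e, e k < d) ↔
        IsSuffixMin e (k + 1 + N) k := by
      rw [List.forall_mem_map]
      refine forall_congr' fun j => ?_
      rw [List.mem_range'_1, Finset.mem_Icc, show j < k + 1 + (N + 1) ↔ j ≤ k + 1 + N by omega]
    rw [List.range'_succ, List.map_cons, suffixMins_cons _ (by simp)]
    simp only [hc]
    ring

section Word

variable {n : ℕ} (σ : Equiv.Perm (Fin n))

theorem length_word : (word σ).length = n := by simp [word]

theorem wB_word {i : ℕ} (h : i < n) : wB (word σ) (i + 1) = σ ⟨i, h⟩ + 1 := by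
  rw [wB, length_word, if_pos (by omega)]
  simp [word, h]

theorem wB_word_zero : wB (word σ) 0 = n + 1 := by simp [wB, length_word]

theorem wB_word_succ : wB (word σ) (n + 1) = n + 1 := by simp [wB, length_word]

theorem wB_word_le {i : ℕ} (h₁ : 1 ≤ i) (h₂ : i ≤ n) : wB (word σ) i ≤ n := by
  obtain ⟨i, rfl⟩ := Nat.exists_eq_add_of_le' h₁
  rw [wB_word σ (by omega)]
  omega

theorem wB_word_ne_succ {i : ℕ} (hn : 1 ≤ n) (h : i ≤ n) :
    wB (word σ) i ≠ wB (word σ) (i + 1) := by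
  obtain _ | i := i
  · have := wB_word_le σ le_rfl hn
    rw [wB_word_zero]
    simp only [zero_add]
    omega
  · obtain rfl | h' := eq_or_lt_of_le h
    · have := wB_word_le σ hn le_rfl
      rw [wB_word_succ]
      omega
    · rw [wB_word σ (by omega), wB_word σ h']
      intro h
      have := σ.injective (Fin.ext (Nat.succ_injective h))
      simp at this

theorem word_eq_map_wB : word σ = (List.range' 1 n).map (wB (word σ)) := by
  refine List.ext_getElem (by simp [length_word]) fun i h₁ h₂ => ?_
  rw [length_word] at h₁
  simp [add_comm 1, wB_word σ h₁]
  simp [word]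

end Word

theorem wordWeight_word {A : Type*} [CommRing A] (p u v t : A) {n : ℕ}
    (σ : Equiv.Perm (Fin (n + 1))) :
    wordWeight p u v t (word σ) = p ^ pkW (word σ) * u ^ daW (word σ) * v ^ ddW (word σ) *
      t ^ (lrminW (word σ) + rlminW (word σ) - 2) := by
  have hw := word_eq_map_wB σ
  have hlen := length_word σ
  have hne := fun i hi => wB_word_ne_succ σ (i := i) (by omega) hi
  have hz := wB_word_zero σ
  have hs := wB_word_succ σ
  have h1 := wB_word_le σ (i := 1) le_rfl (by omega)
  have hN := wB_word_le σ (i := n + 1) (by omega) le_rfl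
  have hI : Finset.Icc 1 (n + 1) = Finset.Ico 1 (n + 2) := by ext; simp; omega
  rw [lrminW_eq_card, rlminW_eq_card]
  unfold pkW daW ddW isPkat isDAat isDDat
  rw [hlen]
  generalize wB (word σ) = e at *
  have hrun := runWeight_map_range' p u v e 0 n (by rw [zero_add, hs]; omega)
  have hpre := prefixMins_map_range' e [e 1] 1 n (by simp)
  have hsuf := suffixMins_map_range' e 1 n
  have hfirst : decide (e 0 < e (0 + 1)) = false := by simp; omega
  rw [hfirst, zero_add, zero_add, ← hI] at hrun
  rw [show 1 + n + 1 = n + 2 by ring, ← hI, add_comm 1 n] at hsuf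
  rw [show 1 + 1 + n = n + 2 by ring] at hpre
  have hlr : ((Finset.Icc 1 (n + 1)).filter (IsPrefixMin e)).card =
        1 + prefixMins [e 1] ((List.range' 2 n).map e) := by
    rw [hpre, hI, Finset.card_filter, Finset.sum_eq_sum_Ico_succ_bot (by omega),
      Finset.card_filter]
    simp
  have hcons : (List.range' 1 (n + 1)).map e = e 1 :: (List.range' 2 n).map e := by
    simp [List.range'_succ]
  rw [hw, hlr, ← hsuf, hcons, wordWeight, ← hcons, hrun]
  congr 1
  · simp only [Finset.card_filter, ← Finset.prod_pow_eq_pow_sum, ← Finset.prod_mul_distrib]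
    refine Finset.prod_congr rfl fun i hi => ?_
    rw [Finset.mem_Icc] at hi
    have h₁ := hne (i - 1) (by omega)
    have h₂ := hne i hi.2
    rw [Nat.sub_add_cancel hi.1] at h₁
    rcases lt_or_gt_of_ne h₁ with h₁ | h₁ <;> rcases lt_or_gt_of_ne h₂ with h₂ | h₂ <;>
      simp [turnWeight, h₁, h₂, h₁.not_gt, h₂.not_gt]
  · congr 1
    omega

theorem desW_word {n : ℕ} (σ : Equiv.Perm (Fin (n + 1))) :
    desW (word σ) = pkW (word σ) + ddW (word σ) := by
  have hne := fun i hi => wB_word_ne_succ σ (i := i) (by omega) hi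
  have hs := wB_word_succ σ
  have hN := wB_word_le σ (i := n + 1) (by omega) le_rfl
  unfold desW pkW ddW isPkat isDDat
  rw [length_word, ← Finset.card_union_of_disjoint]
  · congr 1
    ext i
    simp only [Finset.mem_union, Finset.mem_filter, Finset.mem_Icc]
    constructor
    · rintro ⟨hi, h⟩
      have := hne (i - 1) (by omega)
      rw [Nat.sub_add_cancel hi.1] at this
      omega
    · intro h
      have : i ≠ n + 1 := by
        rintro rfl
        omega
      omega
  · rw [Finset.disjoint_filter]
    intro i _ h
    omega

theorem ascW_word {n : ℕ} (σ : Equiv.Perm (Fin (n + 1))) :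
    ascW (word σ) = pkW (word σ) + daW (word σ) := by
  have hne := fun i hi => wB_word_ne_succ σ (i := i) (by omega) hi
  have hz := wB_word_zero σ
  have h1 := wB_word_le σ (i := 1) le_rfl (by omega)
  unfold ascW pkW daW isPkat isDAat
  rw [length_word, ← Finset.card_union_of_disjoint,
    ← Finset.card_image_of_injective _ (add_left_injective 1)]
  · congr 1
    ext i
    simp only [Finset.mem_union, Finset.mem_filter, Finset.mem_Icc, Finset.mem_image]
    constructor
    · rintro ⟨j, ⟨hj, h⟩, rfl⟩
      have := hne (j + 1) (by omega)
      rw [Nat.add_sub_cancel]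
      omega
    · intro h
      have : i ≠ 1 := by
        rintro rfl
        simp only [Nat.sub_self] at h
        omega
      refine ⟨i - 1, ?_, by omega⟩
      rw [Nat.sub_add_cancel (by omega)]
      omega
  · rw [Finset.disjoint_filter]
    intro i _ h
    omega

/-- The weighted count of permutations depends on `u` and `v` only through `u + v`. -/
theorem sum_wordWeight_eq {R : Type*} [CommRing R] (n : ℕ) {p u v u' v' t : R}
    (h : u + v = u' + v') :
    ∑ σ : Equiv.Perm (Fin (n + 1)), wordWeight p u v t (word σ) =
      ∑ σ : Equiv.Perm (Fin (n + 1)), wordWeight p u' v' t (word σ) := by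
  let X : Fin 4 → MvPolynomial (Fin 4) ℤ := MvPolynomial.X
  let D : Derivation ℤ (MvPolynomial (Fin 4) ℤ) (MvPolynomial (Fin 4) ℤ) :=
    MvPolynomial.mkDerivation ℤ ![X 0 * (X 1 + X 2), X 0, X 0, 0]
  have hmem := sum_wordWeight_permutations'_mem (p := X 0) (u := X 1) (v := X 2) (t := X 3) D
    (by simp [D, X, MvPolynomial.mkDerivation_X]) (by simp [D, X, MvPolynomial.mkDerivation_X])
    (by simp [D, X, MvPolynomial.mkDerivation_X]) (by simp [D, X, MvPolynomial.mkDerivation_X]) n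
  rw [← sum_word] at hmem
  have hev : ∀ u v : R, MvPolynomial.aeval ![p, u, v, t]
      (∑ σ : Equiv.Perm (Fin (n + 1)), wordWeight (X 0) (X 1) (X 2) (X 3) (word σ)) =
      ∑ σ : Equiv.Perm (Fin (n + 1)), wordWeight p u v t (word σ) := by
    intro u v
    simp [wordWeight_word, X]
  rw [← hev, ← hev]
  have hle : Algebra.adjoin ℤ {X 0, X 1 + X 2, X 3} ≤
      AlgHom.equalizer (MvPolynomial.aeval ![p, u, v, t])
        (MvPolynomial.aeval ![p, u', v', t]) := by
    refine Algebra.adjoin_le ?_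
    rintro f (rfl | rfl | rfl) <;> simp [X, h]
  exact hle hmem

/-- Ji: for ring elements with `x + y = u₃ + u₄` and `x·y = u₁·u₂`,
the Stirling-Eulerian polynomial over all of `S_{n+1}` refines via peaks, double ascents
and double descents. -/
theorem stirlingEulerian_refinement {R : Type*} [CommRing R] (n : ℕ) (hn : 1 ≤ n)
    (x y u₁ u₂ u₃ u₄ α : R) (h₁ : x + y = u₃ + u₄) (h₂ : x * y = u₁ * u₂) :
    ∑ σ : Equiv.Perm (Fin (n + 1)), x ^ desW (word σ) * y ^ ascW (word σ) *
        α ^ (lrminW (word σ) + rlminW (word σ) - 2)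
      = ∑ σ : Equiv.Perm (Fin (n + 1)), (u₁ * u₂) ^ pkW (word σ) * u₃ ^ daW (word σ) *
          u₄ ^ ddW (word σ) * α ^ (lrminW (word σ) + rlminW (word σ) - 2) := by
  have hl : ∀ σ : Equiv.Perm (Fin (n + 1)), x ^ desW (word σ) * y ^ ascW (word σ) *
      α ^ (lrminW (word σ) + rlminW (word σ) - 2) = wordWeight (u₁ * u₂) y x α (word σ) := by
    intro σ
    rw [wordWeight_word, desW_word, ascW_word, ← h₂]
    ring
  simp only [hl, ← wordWeight_word]
  exact sum_wordWeight_eq n (by rw [add_comm, h₁])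
end
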